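/- Let 1 ≤ p < q < ∞. Then U_p(ℝ²) ⊂ U_q(ℝ²), and there is a constant c depending only on p and q such that for every f ∈ U_p(ℝ²), ‖N¹_q f‖_{q,1} + ‖N²_q f‖_{q,1} ≤ c (‖N¹_p f‖_{p,1} + ‖N²_p f‖_{p,1}), where N¹_r f(y) = ‖f_y‖_{Lip 1/r} and N²_r f(x) = ‖f_x‖_{Lip 1/r}. -/

import Mathlib

open MeasureTheory Set
open scoped ENNReal

noncomputable section

/-- Extended essential sup norm on ℝ. -/
def einf (φ : ℝ → ℝ) : ℝ≥0∞ := eLpNorm φ ⊤ volume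

/-- Lipschitz `α` seminorm (extended real valued):
`sup_{h>0} h^{-α} ‖φ(·+h) - φ‖_∞`. -/
def lipSemiE (α : ℝ) (φ : ℝ → ℝ) : ℝ≥0∞ :=
  ⨆ h ∈ Ioi (0:ℝ), ENNReal.ofReal (h ^ (-α)) * einf (fun x => φ (x + h) - φ x)

/-- Real-valued Lipschitz `α` seminorm `‖φ‖*_{Lip α}`. -/
def lipSemi (α : ℝ) (φ : ℝ → ℝ) : ℝ := (lipSemiE α φ).toReal

/-- `φ ∈ Lip α`: essentially bounded with finite Lipschitz `α` seminorm. -/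
def MemLip (α : ℝ) (φ : ℝ → ℝ) : Prop := einf φ < ⊤ ∧ lipSemiE α φ < ⊤

/-- `‖φ‖_{Lip α} = ‖φ‖_∞ + ‖φ‖*_{Lip α}`. -/
def lipNorm (α : ℝ) (φ : ℝ → ℝ) : ℝ := (einf φ + lipSemiE α φ).toReal

/-- The class `S₀`: measurable functions with finite distribution function at every
positive level. -/
def S0 {X : Type*} [MeasureSpace X] (f : X → ℝ) : Prop :=
  Measurable f ∧ ∀ s : ℝ, 0 < s → volume {x | s < |f x|} < ⊤

/-- The non-increasing rearrangement `f*`. -/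
def rearr {X : Type*} [MeasureSpace X] (f : X → ℝ) (t : ℝ) : ℝ :=
  sInf {s : ℝ | 0 ≤ s ∧ volume {x | s < |f x|} ≤ ENNReal.ofReal t}

/-- `f**(t) = (1/t) ∫₀^t f*(u) du`. -/
def doubleStar {X : Type*} [MeasureSpace X] (f : X → ℝ) (t : ℝ) : ℝ :=
  (∫ u in Ioc (0:ℝ) t, rearr f u) / t

/-- Lorentz `L^{p,q}` norm. -/
def lorentzNorm {X : Type*} [MeasureSpace X] (p q : ℝ) (f : X → ℝ) : ℝ :=
  (∫ t in Ioi (0:ℝ), (t ^ (1/p) * rearr f t) ^ q / t) ^ (1/q)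

/-- Membership in the Lorentz space `L^{p,q}`. -/
def MemLorentz {X : Type*} [MeasureSpace X] (p q : ℝ) (f : X → ℝ) : Prop :=
  S0 f ∧ IntegrableOn (fun t => (t ^ (1/p) * rearr f t) ^ q / t) (Ioi (0:ℝ))

/-- The space `U_p(ℝ²)`: a.e. sections in `Lip (1/p)`, with `Lip (1/p)` norms of the
sections in `L^{p,1}(ℝ)`. -/
def MemUp (p : ℝ) (f : ℝ × ℝ → ℝ) : Prop :=
  Measurable f ∧
  (∀ᵐ y : ℝ ∂volume, MemLip (1/p) (fun x => f (x, y))) ∧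
  (∀ᵐ x : ℝ ∂volume, MemLip (1/p) (fun y => f (x, y))) ∧
  MemLorentz p 1 (fun y => lipNorm (1/p) (fun x => f (x, y))) ∧
  MemLorentz p 1 (fun x => lipNorm (1/p) (fun y => f (x, y)))

/-- The Steklov-type average `f_h`. -/
def avg (f : ℝ × ℝ → ℝ) (h : ℝ) (z : ℝ × ℝ) : ℝ :=
  (∫ u in Ioc (0:ℝ) h, ∫ v in Ioc (0:ℝ) h, f (z.1 + u, z.2 + v)) / h ^ 2

lemma einf_le_iff {φ : ℝ → ℝ} {c : ℝ≥0∞} : einf φ ≤ c ↔ ∀ᵐ x, ‖φ x‖ₑ ≤ c := by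
  unfold einf
  rw [eLpNorm_exponent_top, eLpNormEssSup]
  exact ⟨fun h => (ae_le_essSup (f := fun x => ‖φ x‖ₑ)).mono fun x hx => hx.trans h,
    fun h => essSup_le_of_ae_le _ h⟩

lemma ae_enorm_le_einf (φ : ℝ → ℝ) : ∀ᵐ x, ‖φ x‖ₑ ≤ einf φ := einf_le_iff.1 le_rfl

lemma ae_comp_add_right {P : ℝ → Prop} (h : ∀ᵐ x, P x) (k : ℝ) : ∀ᵐ x, P (x + k) :=
  (measurePreserving_add_right volume k).quasiMeasurePreserving.ae h

lemma ae_comp_add_left {P : ℝ → Prop} (h : ∀ᵐ x, P x) (k : ℝ) : ∀ᵐ x, P (k + x) :=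
  (measurePreserving_add_left volume k).quasiMeasurePreserving.ae h

/-- An interval longer than the measure of an exceptional set contains a good point. -/
lemma exists_mem_Ioo_of_volume_lt {P Q : ℝ → Prop} (hP : ∀ᵐ x, P x) {a L : ℝ}
    (hQ : volume {x | ¬ Q x} < ENNReal.ofReal L) : ∃ x ∈ Ioo a (a + L), P x ∧ Q x := by
  by_contra! hcon
  refine absurd hQ (not_lt.2 ?_)
  calc ENNReal.ofReal L = volume (Ioo a (a + L)) := by rw [Real.volume_Ioo]; congr 1; ring
    _ ≤ volume {x | ¬ Q x} := measure_mono_ae (hP.mono fun x hx hmem => hcon x hmem hx)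

lemma exists_mem_Ioo_of_ae {P : ℝ → Prop} (hP : ∀ᵐ x, P x) {L : ℝ} (hL : 0 < L) :
    ∃ x ∈ Ioo 0 L, P x := by
  obtain ⟨x, hx, h, -⟩ := exists_mem_Ioo_of_volume_lt (Q := fun _ => True) hP (a := 0) (L := L)
    (by simpa using hL)
  exact ⟨x, by simpa using hx, h⟩

lemma einf_add_le (φ ψ : ℝ → ℝ) : einf (fun x => φ x + ψ x) ≤ einf φ + einf ψ := by
  rw [einf_le_iff]
  filter_upwards [ae_enorm_le_einf φ, ae_enorm_le_einf ψ] with x h1 h2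
  exact (enorm_add_le _ _).trans (add_le_add h1 h2)

lemma einf_neg (φ : ℝ → ℝ) : einf (fun x => -φ x) = einf φ := by
  unfold einf
  exact eLpNorm_neg φ ⊤ volume

lemma einf_comp_add (φ : ℝ → ℝ) (k : ℝ) : einf (fun x => φ (x + k)) ≤ einf φ :=
  einf_le_iff.2 (ae_comp_add_right (ae_enorm_le_einf φ) k)

lemma einf_diff_le (φ : ℝ → ℝ) (h : ℝ) : einf (fun x => φ (x + h) - φ x) ≤ 2 * einf φ := by
  simp only [sub_eq_add_neg]
  refine (einf_add_le _ _).trans ?_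
  rw [einf_neg, two_mul]
  gcongr
  exact einf_comp_add φ h

lemma lipSemiE_add_le (α : ℝ) (φ ψ : ℝ → ℝ) :
    lipSemiE α (fun x => φ x + ψ x) ≤ lipSemiE α φ + lipSemiE α ψ := by
  refine iSup₂_le fun h hh => ?_
  have key : einf (fun x => φ (x + h) + ψ (x + h) - (φ x + ψ x)) ≤
      einf (fun x => φ (x + h) - φ x) + einf (fun x => ψ (x + h) - ψ x) := by
    refine le_trans (le_of_eq ?_) (einf_add_le _ _)
    congr 1; ext x; ring
  calc
    _ ≤ ENNReal.ofReal (h ^ (-α)) * _ := by gcongr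
    _ = _ := mul_add _ _ _
    _ ≤ _ := add_le_add
      (le_iSup₂ (f := fun (h : ℝ) (_ : h ∈ Ioi (0:ℝ)) =>
        ENNReal.ofReal (h ^ (-α)) * einf (fun x => φ (x + h) - φ x)) h hh)
      (le_iSup₂ (f := fun (h : ℝ) (_ : h ∈ Ioi (0:ℝ)) =>
        ENNReal.ofReal (h ^ (-α)) * einf (fun x => ψ (x + h) - ψ x)) h hh)

lemma lipSemiE_neg (α : ℝ) (φ : ℝ → ℝ) : lipSemiE α (fun x => -φ x) = lipSemiE α φ := by
  unfold lipSemiE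
  congr! 4 with h _
  rw [← einf_neg]
  congr 1; ext x; ring

lemma lipSemiE_le_iff {α : ℝ} {φ : ℝ → ℝ} {M : ℝ≥0∞} :
    lipSemiE α φ ≤ M ↔
      ∀ h : ℝ, 0 < h → einf (fun x => φ (x + h) - φ x) ≤ ENNReal.ofReal (h ^ α) * M := by
  unfold lipSemiE
  simp only [iSup_le_iff, mem_Ioi]
  refine forall₂_congr fun h hh => ?_
  have hpos : 0 < h ^ α := Real.rpow_pos_of_pos hh α
  rw [Real.rpow_neg hh.le, ENNReal.ofReal_inv_of_pos hpos,
    ENNReal.inv_mul_le_iff (by simpa using hpos) ENNReal.ofReal_ne_top]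

/-- Interpolation between the sup norm and a Lipschitz seminorm of higher order. -/
lemma lipSemiE_interpolate {α β s : ℝ} (hα : 0 ≤ α) (hαβ : α ≤ β) (hs : 0 < s) {φ : ℝ → ℝ}
    {A : ℝ≥0∞} (h0 : einf φ ≤ ENNReal.ofReal (s ^ β) * A) (h1 : lipSemiE β φ ≤ A) :
    lipSemiE α φ ≤ ENNReal.ofReal (s ^ (β - α)) * (2 * A) := by
  rw [lipSemiE_le_iff] at h1 ⊢
  intro h hh
  have e : ∀ r : ℝ, 0 < r → r ^ β = r ^ α * r ^ (β - α) := fun r hr => by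
    rw [← Real.rpow_add hr]; congr 1; ring
  rw [← mul_assoc, ← ENNReal.ofReal_mul (by positivity)]
  rcases le_total h s with hle | hle
  · refine (h1 h hh).trans (mul_le_mul' (ENNReal.ofReal_le_ofReal ?_)
      (le_mul_of_one_le_left' one_le_two))
    rw [e h hh]
    gcongr
  · refine (einf_diff_le φ h).trans ?_
    calc 2 * einf φ ≤ 2 * (ENNReal.ofReal (s ^ β) * A) := by gcongr
      _ = ENNReal.ofReal (s ^ β) * (2 * A) := by ring
      _ ≤ _ := by
        gcongr
        rw [e s hs]
        gcongr

/-- The supremum over increments is controlled by almost every increment. -/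
lemma lipSemiE_eq_essSup {α : ℝ} (hα : 0 < α) (φ : ℝ → ℝ) :
    lipSemiE α φ = essSup (fun h : ℝ => ENNReal.ofReal (h ^ (-α)) *
      einf (fun x => φ (x + h) - φ x)) (volume.restrict (Ioi (0:ℝ))) := by
  apply le_antisymm
  · set M := essSup (fun h : ℝ => ENNReal.ofReal (h ^ (-α)) *
      einf (fun x => φ (x + h) - φ x)) (volume.restrict (Ioi (0:ℝ))) with hM
    rcases eq_or_ne M ⊤ with hT | hT
    · rw [hT]; exact le_top
    have hae : ∀ᵐ h : ℝ, 0 < h →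
        einf (fun x => φ (x + h) - φ x) ≤ ENNReal.ofReal (h ^ α) * M := by
      have := ae_le_essSup (μ := volume.restrict (Ioi (0:ℝ))) (f := fun h : ℝ =>
        ENNReal.ofReal (h ^ (-α)) * einf (fun x => φ (x + h) - φ x))
      rw [ae_restrict_iff' measurableSet_Ioi] at this
      filter_upwards [this] with h hh hpos
      have hpos' : 0 < h ^ α := Real.rpow_pos_of_pos hpos α
      have h2 := hh hpos
      rwa [Real.rpow_neg hpos.le, ENNReal.ofReal_inv_of_pos hpos',
        ENNReal.inv_mul_le_iff (by simpa using hpos') ENNReal.ofReal_ne_top] at h2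
    rw [lipSemiE_le_iff]
    intro h hh
    have hae2 : ∀ᵐ k : ℝ, 0 < h - k →
        einf (fun x => φ (x + (h - k)) - φ x) ≤ ENNReal.ofReal ((h - k) ^ α) * M :=
      (Measure.measurePreserving_sub_left volume h).quasiMeasurePreserving.ae hae
    have hsplit : ∀ᵐ k : ℝ, k ∈ Ioo 0 h → einf (fun x => φ (x + h) - φ x) ≤
        ENNReal.ofReal (k ^ α + (h - k) ^ α) * M := by
      filter_upwards [hae, hae2] with k h1 h2 hk
      have hk2 : 0 < h - k := sub_pos.2 hk.2
      rw [ENNReal.ofReal_add (Real.rpow_nonneg hk.1.le _) (Real.rpow_nonneg hk2.le _), add_mul]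
      refine le_trans ?_ (add_le_add (h1 hk.1) (h2 hk2))
      refine le_trans ?_ (add_le_add_left (einf_comp_add _ (h - k)) _)
      refine le_trans (le_of_eq ?_) (einf_add_le _ _)
      congr 1; ext x
      rw [show x + (h - k) + k = x + h by ring]; ring
    have hcont : Filter.Tendsto (fun k : ℝ => ENNReal.ofReal (k ^ α + (h - k) ^ α) * M)
        (nhds 0) (nhds (ENNReal.ofReal (h ^ α) * M)) := by
      refine ENNReal.Tendsto.mul_const (ENNReal.tendsto_ofReal ?_) (Or.inr hT)
      have : Continuous fun k : ℝ => k ^ α + (h - k) ^ α :=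
        (Real.continuous_rpow_const hα.le).add
          ((Real.continuous_rpow_const hα.le).comp (continuous_const.sub continuous_id))
      simpa [Real.zero_rpow hα.ne'] using this.tendsto 0
    by_contra! hlt
    obtain ⟨δ, hδ, hball⟩ := Metric.eventually_nhds_iff.1 (hcont.eventually_lt_const hlt)
    obtain ⟨k, hk, hk'⟩ := exists_mem_Ioo_of_ae hsplit (lt_min hδ hh)
    refine absurd (hk' ⟨hk.1, hk.2.trans_le (min_le_right _ _)⟩) (not_le.2 (hball ?_))
    rw [Real.dist_eq, sub_zero, abs_of_pos hk.1]
    exact hk.2.trans_le (min_le_left _ _)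
  · refine essSup_le_of_ae_le _ ?_
    refine (ae_restrict_mem measurableSet_Ioi).mono fun h hh => ?_
    exact (le_iSup₂ (f := fun (h : ℝ) (_ : h ∈ Ioi (0:ℝ)) =>
        ENNReal.ofReal (h ^ (-α)) * einf (fun x => φ (x + h) - φ x)) h hh)

lemma measurable_essSup_section {X Y : Type*} [MeasurableSpace X] [MeasurableSpace Y]
    {ν : Measure Y} [SFinite ν] {g : X × Y → ℝ≥0∞} (hg : Measurable g) :
    Measurable fun a => essSup (fun b => g (a, b)) ν := by
  refine measurable_of_Iic fun c => ?_
  have : (fun a => essSup (fun b => g (a, b)) ν) ⁻¹' Iic c =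
      (fun a => ν (Prod.mk a ⁻¹' {z | c < g z})) ⁻¹' {0} := by
    ext a
    simp only [mem_preimage, mem_Iic, mem_singleton_iff]
    have : ν (Prod.mk a ⁻¹' {z | c < g z}) = 0 ↔ ∀ᵐ b ∂ν, g (a, b) ≤ c := by
      rw [ae_iff]; simp [preimage]
    rw [this]
    exact ⟨fun h => (ae_le_essSup (f := fun b => g (a, b))).mono fun x hx => hx.trans h,
      fun h => essSup_le_of_ae_le _ h⟩
  rw [this]
  exact measurable_measure_prodMk_left (measurableSet_lt measurable_const hg)
    (measurableSet_singleton 0)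

lemma measurable_einf_section {X : Type*} [MeasurableSpace X] {g : X × ℝ → ℝ}
    (hg : Measurable g) : Measurable fun a => einf (fun x => g (a, x)) := by
  unfold einf
  simp only [eLpNorm_exponent_top, eLpNormEssSup]
  exact measurable_essSup_section (g := fun z => ‖g z‖ₑ) hg.enorm

lemma measurable_lipNorm_section {α : ℝ} (hα : 0 < α) {f : ℝ × ℝ → ℝ} (hf : Measurable f) :
    Measurable fun y => lipNorm α (fun x => f (x, y)) := by
  unfold lipNorm
  simp only [lipSemiE_eq_essSup hα]
  refine (Measurable.add ?_ ?_).ennreal_toReal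
  · exact measurable_einf_section (g := fun z => f (z.2, z.1)) (hf.comp measurable_swap)
  · refine measurable_essSup_section (g := fun z : ℝ × ℝ => ENNReal.ofReal (z.2 ^ (-α)) *
      einf (fun x => f (x + z.2, z.1) - f (x, z.1))) ?_
    refine Measurable.mul (by fun_prop) ?_
    exact measurable_einf_section
      (g := fun w : (ℝ × ℝ) × ℝ => f (w.2 + w.1.2, w.1.1) - f (w.2, w.1.1)) (by fun_prop)

lemma ae_enorm_diff_le {α : ℝ} {φ : ℝ → ℝ} {A : ℝ≥0∞} (hA : lipSemiE α φ ≤ A) {h : ℝ}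
    (hh : 0 < h) : ∀ᵐ x, ‖φ (x + h) - φ x‖ₑ ≤ ENNReal.ofReal (h ^ α) * A :=
  einf_le_iff.1 (lipSemiE_le_iff.1 hA h hh)

lemma ae_ae_enorm_diff_le {α : ℝ} {φ : ℝ → ℝ} (hφ : Measurable φ) {A : ℝ≥0∞}
    (hA : lipSemiE α φ ≤ A) :
    ∀ᵐ x, ∀ᵐ h, 0 < h → ‖φ (x + h) - φ x‖ₑ ≤ ENNReal.ofReal (h ^ α) * A := by
  refine (Measure.ae_ae_comm (p := fun h x : ℝ => 0 < h →
    ‖φ (x + h) - φ x‖ₑ ≤ ENNReal.ofReal (h ^ α) * A) ?_).1 ?_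
  · refine MeasurableSet.imp (measurableSet_lt (by fun_prop) (by fun_prop))
      (measurableSet_le (by fun_prop) (by fun_prop))
  · refine Filter.Eventually.of_forall fun h => ?_
    by_cases hh : 0 < h
    · exact (ae_enorm_diff_le hA hh).mono fun x hx _ => hx
    · exact Filter.Eventually.of_forall fun x hh' => absurd hh' hh

lemma ae_section_diff {α : ℝ} {f : ℝ × ℝ → ℝ} (hf : Measurable f) {b : ℝ → ℝ}
    (hb : Measurable b)
    (h : ∀ᵐ x, lipSemiE α (fun y => f (x, y)) ≤ ENNReal.ofReal (b x)) :
    ∀ᵐ y, ∀ᵐ k, 0 < k →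
      ∀ᵐ x, ‖f (x, y + k) - f (x, y)‖ₑ ≤ ENNReal.ofReal (k ^ α) * ENNReal.ofReal (b x) := by
  set P : ℝ × ℝ → ℝ → Prop := fun z x => 0 < z.1 →
    ‖f (x, z.2 + z.1) - f (x, z.2)‖ₑ ≤ ENNReal.ofReal (z.1 ^ α) * ENNReal.ofReal (b x) with hP
  have hPm : MeasurableSet {w : (ℝ × ℝ) × ℝ | P w.1 w.2} :=
    MeasurableSet.imp (measurableSet_lt (by fun_prop) (by fun_prop))
      (measurableSet_le (by fun_prop) (by fun_prop))
  have hPm2 : MeasurableSet {z : ℝ × ℝ | ∀ᵐ x, P z x} := by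
    have := measurable_measure_prodMk_left (ν := (volume : Measure ℝ)) hPm.compl
      (measurableSet_singleton 0)
    exact this
  have key : ∀ᵐ k : ℝ, ∀ᵐ y : ℝ, ∀ᵐ x : ℝ, P (k, y) x := by
    refine Filter.Eventually.of_forall fun k => ?_
    rw [Measure.ae_ae_comm (p := fun y x => P (k, y) x)]
    · filter_upwards [h] with x hx
      by_cases hk : 0 < k
      · exact (ae_enorm_diff_le hx hk).mono fun y hy _ => hy
      · exact Filter.Eventually.of_forall fun y hk' => absurd hk' hk
    · exact hPm.preimage (f := fun w : ℝ × ℝ => ((k, w.1), w.2)) (by fun_prop)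
  rw [Measure.ae_ae_comm (p := fun k y => ∀ᵐ x : ℝ, P (k, y) x) hPm2] at key
  exact key.mono fun y hy => hy.mono fun k hk hk0 => hk.mono fun x hx => hx hk0

/-- Two Lipschitz functions which are close off a set of measure at most `t` are uniformly
close, up to their oscillation at scale `t`. -/
lemma einf_sub_le {α t : ℝ} (hα : 0 ≤ α) (ht : 0 < t) {φ ψ : ℝ → ℝ} (hφ : Measurable φ)
    (hψ : Measurable ψ) {A D : ℝ≥0∞} (hAφ : lipSemiE α φ ≤ A) (hAψ : lipSemiE α ψ ≤ A)
    {Q : ℝ → Prop} (hQ : volume {x | ¬ Q x} ≤ ENNReal.ofReal t)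
    (hD : ∀ᵐ x, Q x → ‖ψ x - φ x‖ₑ ≤ D) :
    einf (fun x => φ x - ψ x) ≤ 2 * (ENNReal.ofReal ((2 * t) ^ α) * A) + D := by
  rw [einf_le_iff]
  filter_upwards [ae_ae_enorm_diff_le hφ hAφ, ae_ae_enorm_diff_le hψ hAψ] with x h1 h2
  have hvol : volume {h | ¬ Q (x + h)} < ENNReal.ofReal (2 * t) := by
    have : volume {h | ¬ Q (x + h)} = volume {y | ¬ Q y} :=
      measure_preimage_add volume x {y | ¬ Q y}
    rw [this]
    exact hQ.trans_lt ((ENNReal.ofReal_lt_ofReal_iff (by linarith)).2 (by linarith))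
  obtain ⟨h, ⟨hpos, hlt⟩, ⟨h3, h4, h5⟩, hq⟩ := exists_mem_Ioo_of_volume_lt (a := 0)
    (h1.and (h2.and (ae_comp_add_left hD x))) hvol
  have hle : ENNReal.ofReal (h ^ α) * A ≤ ENNReal.ofReal ((2 * t) ^ α) * A := by
    gcongr
    linarith
  have e : φ x - ψ x = (ψ (x + h) - ψ x) + (-(φ (x + h) - φ x) + -(ψ (x + h) - φ (x + h))) := by
    ring
  rw [e, two_mul, add_assoc]
  refine (enorm_add_le _ _).trans (add_le_add ((h4 hpos).trans hle)
    ((enorm_add_le _ _).trans (add_le_add ?_ ?_)))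
  · rw [enorm_neg]; exact (h3 hpos).trans hle
  · rw [enorm_neg]; exact h5 hq

section Rearrangement

variable {X : Type*} [MeasureSpace X] {g : X → ℝ}

lemma rearr_nonneg (g : X → ℝ) (t : ℝ) : 0 ≤ rearr g t := Real.sInf_nonneg fun _ h => h.1

lemma rearr_le {s t : ℝ} (hs : 0 ≤ s) (h : volume {x | s < |g x|} ≤ ENNReal.ofReal t) :
    rearr g t ≤ s := csInf_le ⟨0, fun _ h => h.1⟩ ⟨hs, h⟩

lemma exists_volume_lt_abs_le (hg : S0 g) {t : ℝ} (ht : 0 < t) :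
    ∃ s : ℝ, 0 ≤ s ∧ volume {x | s < |g x|} ≤ ENNReal.ofReal t := by
  have hlim : Filter.Tendsto (fun n : ℕ => volume {x | (n : ℝ) < |g x|}) Filter.atTop
      (nhds (volume (⋂ n : ℕ, {x | (n : ℝ) < |g x|}))) := by
    refine tendsto_measure_iInter_atTop
      (fun n => (measurableSet_lt measurable_const hg.1.abs).nullMeasurableSet) ?_
      ⟨1, (hg.2 _ (by norm_num)).ne⟩
    intro m n hmn x hx
    exact lt_of_le_of_lt (Nat.cast_le.2 hmn) (mem_ofPred.1 hx)
  have hempty : (⋂ n : ℕ, {x | (n : ℝ) < |g x|}) = ∅ := by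
    ext x
    simp only [mem_iInter, mem_ofPred_eq, mem_empty_iff_false, iff_false, not_forall, not_lt]
    exact exists_nat_ge _
  rw [hempty, measure_empty] at hlim
  obtain ⟨n, hn⟩ := (hlim.eventually_le_const (ENNReal.ofReal_pos.2 ht)).exists
  exact ⟨n, n.cast_nonneg, hn⟩

lemma volume_rearr_lt_le (hg : S0 g) {t : ℝ} (ht : 0 < t) :
    volume {x | rearr g t < |g x|} ≤ ENNReal.ofReal t := by
  have hU : {x | rearr g t < |g x|} = ⋃ n : ℕ, {x | rearr g t + 1 / ((n : ℝ) + 1) < |g x|} := by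
    ext x
    simp only [mem_ofPred_eq, mem_iUnion]
    constructor
    · intro h
      obtain ⟨n, hn⟩ := exists_nat_one_div_lt (sub_pos.2 h)
      exact ⟨n, by linarith⟩
    · rintro ⟨n, hn⟩
      have : (0 : ℝ) < 1 / ((n : ℝ) + 1) := by positivity
      linarith
  have hmono : Monotone fun n : ℕ => {x | rearr g t + 1 / ((n : ℝ) + 1) < |g x|} := by
    intro m n hmn x hx
    have : 1 / ((n : ℝ) + 1) ≤ 1 / ((m : ℝ) + 1) := by gcongr
    simp only [mem_ofPred_eq] at hx ⊢
    linarith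
  rw [hU, hmono.measure_iUnion]
  refine iSup_le fun n => ?_
  have hpos : (0 : ℝ) < 1 / ((n : ℝ) + 1) := by positivity
  obtain ⟨s, hs, hlt⟩ := exists_lt_of_csInf_lt (exists_volume_lt_abs_le hg ht)
    (lt_add_of_pos_right (rearr g t) hpos)
  exact (measure_mono fun x hx => hlt.trans hx).trans hs.2

lemma rearr_antitoneOn (hg : S0 g) : AntitoneOn (rearr g) (Ioi 0) := fun _ hs _ _ hst =>
  rearr_le (rearr_nonneg g _) ((volume_rearr_lt_le hg hs).trans (ENNReal.ofReal_le_ofReal hst))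

lemma S0_of_ae_le {m : X → ℝ} (hg : S0 g) (hm : Measurable m) {c : ℝ} (hc : 0 < c)
    (h : ∀ᵐ x, |m x| ≤ c * |g x|) : S0 m := by
  refine ⟨hm, fun s hs => (measure_mono_ae ?_).trans_lt (hg.2 (s / c) (by positivity))⟩
  filter_upwards [h] with x hx hmem
  exact (div_lt_iff₀' hc).2 (lt_of_lt_of_le hmem hx)

lemma rearr_le_mul_of_ae_le {m : X → ℝ} (hg : S0 g) {c : ℝ} (hc : 0 < c)
    (h : ∀ᵐ x, |m x| ≤ c * |g x|) {t : ℝ} (ht : 0 < t) : rearr m t ≤ c * rearr g t := by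
  refine rearr_le (mul_nonneg hc.le (rearr_nonneg g t))
    ((measure_mono_ae ?_).trans (volume_rearr_lt_le hg ht))
  filter_upwards [h] with x hx hmem
  exact lt_of_mul_lt_mul_left (lt_of_lt_of_le hmem hx) hc.le

end Rearrangement

lemma lipNorm_nonneg (α : ℝ) (φ : ℝ → ℝ) : 0 ≤ lipNorm α φ := ENNReal.toReal_nonneg

lemma MemLip.add_eq {α : ℝ} {φ : ℝ → ℝ} (h : MemLip α φ) :
    einf φ + lipSemiE α φ = ENNReal.ofReal (lipNorm α φ) :=
  (ENNReal.ofReal_toReal (ENNReal.add_lt_top.2 h).ne).symm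

lemma MemLip.lipSemiE_le {α : ℝ} {φ : ℝ → ℝ} (h : MemLip α φ) :
    lipSemiE α φ ≤ ENNReal.ofReal (lipNorm α φ) := h.add_eq ▸ le_add_self

lemma einf_add_lipSemiE_le {α β : ℝ} (hα : 0 ≤ α) (hαβ : α ≤ β) {φ : ℝ → ℝ} (h : MemLip β φ) :
    einf φ + lipSemiE α φ ≤ ENNReal.ofReal (3 * lipNorm β φ) := by
  have h0 : einf φ ≤ ENNReal.ofReal (lipNorm β φ) := h.add_eq ▸ le_self_add
  have := lipSemiE_interpolate hα hαβ one_pos (by simpa using h0) h.lipSemiE_le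
  refine (add_le_add h0 this).trans (le_of_eq ?_)
  rw [Real.one_rpow, ENNReal.ofReal_one, ENNReal.ofReal_mul (by norm_num)]
  norm_num
  ring

lemma MemLip.mono {α β : ℝ} (hα : 0 ≤ α) (hαβ : α ≤ β) {φ : ℝ → ℝ} (h : MemLip β φ) :
    MemLip α φ :=
  ENNReal.add_lt_top.1 ((einf_add_lipSemiE_le hα hαβ h).trans_lt ENNReal.ofReal_lt_top)

lemma lipNorm_le_three_mul {α β : ℝ} (hα : 0 ≤ α) (hαβ : α ≤ β) {φ : ℝ → ℝ} (h : MemLip β φ) :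
    lipNorm α φ ≤ 3 * lipNorm β φ :=
  ENNReal.toReal_le_of_le_ofReal (by linarith [lipNorm_nonneg β φ])
    (einf_add_lipSemiE_le hα hαβ h)

/-- The basic self-improving estimate for the rearrangement of the section norms. -/
lemma rearr_lipNorm_step {α β : ℝ} (hα : 0 < α) (hαβ : α ≤ β) (hβ : β ≤ 1) {f : ℝ × ℝ → ℝ}
    (hf : Measurable f) {a b n : ℝ → ℝ} (ha : a = fun y => lipNorm β fun x => f (x, y))
    (hb : b = fun x => lipNorm β fun y => f (x, y))
    (hn : n = fun y => lipNorm α fun x => f (x, y))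
    (h1 : ∀ᵐ y, MemLip β fun x => f (x, y)) (h2 : ∀ᵐ x, MemLip β fun y => f (x, y))
    (ha0 : S0 a) (hb0 : S0 b) (hn0 : S0 n) {t : ℝ} (ht : 0 < t) (ht1 : t ≤ 1) :
    rearr n t ≤ 24 * t ^ (β - α) * (rearr a t + rearr b t) + rearr n (2 * t) := by
  have hβ0 : 0 ≤ β := hα.le.trans hαβ
  have ea : ∀ y, a y = lipNorm β fun x => f (x, y) := fun y => by rw [ha]
  have en : ∀ y, n y = lipNorm α fun x => f (x, y) := fun y => by rw [hn]
  have ra := rearr_nonneg a t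
  have rb := rearr_nonneg b t
  have rn := rearr_nonneg n (2 * t)
  refine rearr_le (by positivity) ((measure_mono_ae ?_).trans (volume_rearr_lt_le ha0 ht))
  have hdiff := ae_section_diff (α := β) hf hb0.1 (h2.mono fun x hx => by
    rw [hb]; exact hx.lipSemiE_le)
  filter_upwards [h1, hdiff] with y hy hyk hlt
  by_contra hay
  have hay : |a y| ≤ rearr a t := not_lt.1 hay
  refine absurd hlt (not_lt.2 ?_)
  have hvol : volume {k | ¬ (|a (y + k)| ≤ rearr a t ∧ |n (y + k)| ≤ rearr n (2 * t))} <
      ENNReal.ofReal (4 * t) := by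
    have e : {k | ¬ (|a (y + k)| ≤ rearr a t ∧ |n (y + k)| ≤ rearr n (2 * t))} =
        (fun k => y + k) ⁻¹' ({z | rearr a t < |a z|} ∪ {z | rearr n (2 * t) < |n z|}) := by
      ext k
      simp only [mem_ofPred_eq, mem_preimage, mem_union, not_and_or, not_le]
    rw [e, measure_preimage_add]
    refine (measure_union_le _ _).trans_lt ((add_le_add (volume_rearr_lt_le ha0 ht)
      (volume_rearr_lt_le hn0 (by linarith))).trans_lt ?_)
    rw [← ENNReal.ofReal_add ht.le (by linarith), ENNReal.ofReal_lt_ofReal_iff (by linarith)]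
    linarith
  obtain ⟨k, ⟨hk0, hk4⟩, ⟨hk1, hk2⟩, hka, hkn⟩ := exists_mem_Ioo_of_volume_lt (a := 0)
    ((ae_comp_add_left h1 y).and hyk) hvol
  rw [zero_add] at hk4
  set φ : ℝ → ℝ := fun x => f (x, y) with hφ
  set ψ : ℝ → ℝ := fun x => f (x, y + k) with hψ
  set A := ENNReal.ofReal (rearr a t)
  set B := ENNReal.ofReal (rearr b t)
  have hAφ : lipSemiE β φ ≤ A := hy.lipSemiE_le.trans (ENNReal.ofReal_le_ofReal (by
    rw [ea] at hay; exact (le_abs_self _).trans hay))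
  have hAψ : lipSemiE β ψ ≤ A := hk1.lipSemiE_le.trans (ENNReal.ofReal_le_ofReal (by
    rw [ea] at hka; exact (le_abs_self _).trans hka))
  have hsup : einf (fun x => φ x - ψ x) ≤ ENNReal.ofReal ((4 * t) ^ β) * (2 * (A + B)) := by
    have hb' : volume {x | ¬ |b x| ≤ rearr b t} ≤ ENNReal.ofReal t := by
      simpa only [not_le] using volume_rearr_lt_le hb0 ht
    refine (einf_sub_le hβ0 ht (by fun_prop) (by fun_prop) hAφ hAψ hb'
      (D := ENNReal.ofReal ((4 * t) ^ β) * B) ?_).trans ?_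
    · filter_upwards [hk2 hk0] with x hx hbx
      refine hx.trans ?_
      exact mul_le_mul' (ENNReal.ofReal_le_ofReal (Real.rpow_le_rpow hk0.le hk4.le hβ0))
        (ENNReal.ofReal_le_ofReal ((le_abs_self _).trans hbx))
    · have : ENNReal.ofReal ((2 * t) ^ β) ≤ ENNReal.ofReal ((4 * t) ^ β) := by
        gcongr; norm_num
      calc _ ≤ 2 * (ENNReal.ofReal ((4 * t) ^ β) * A) + 2 * (ENNReal.ofReal ((4 * t) ^ β) * B) := by
            refine add_le_add (by gcongr) ?_
            rw [two_mul]; exact le_self_add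
        _ = _ := by ring
  have hsemi : lipSemiE β (fun x => φ x - ψ x) ≤ 2 * (A + B) := by
    simp only [sub_eq_add_neg]
    refine (lipSemiE_add_le _ _ _).trans ?_
    rw [lipSemiE_neg, two_mul]
    exact add_le_add (hAφ.trans le_self_add) (hAψ.trans le_self_add)
  have hsemi' := lipSemiE_interpolate hα.le hαβ (by positivity : 0 < 4 * t) hsup hsemi
  have h4 : ∀ r, 0 ≤ r → r ≤ 1 → β - α ≤ r → (4 * t) ^ r ≤ 4 * t ^ (β - α) := by
    intro r hr0 hr1 hr
    rw [Real.mul_rpow (by norm_num) ht.le]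
    refine mul_le_mul ?_ (Real.rpow_le_rpow_of_exponent_ge ht ht1 hr) (by positivity) (by norm_num)
    simpa using Real.rpow_le_rpow_of_exponent_le (x := 4) (by norm_num) hr1
  have htot : einf φ + lipSemiE α φ ≤
      ENNReal.ofReal (24 * t ^ (β - α) * (rearr a t + rearr b t) + rearr n (2 * t)) := by
    have hnψ : einf ψ + lipSemiE α ψ ≤ ENNReal.ofReal (rearr n (2 * t)) := by
      rw [(hk1.mono hα.le hαβ).add_eq]
      rw [en] at hkn
      exact ENNReal.ofReal_le_ofReal ((le_abs_self _).trans hkn)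
    have hφe : φ = fun x => (φ x - ψ x) + ψ x := by ext x; ring
    have hs : einf (fun x => φ x - ψ x) + lipSemiE α (fun x => φ x - ψ x) ≤
        ENNReal.ofReal (24 * t ^ (β - α) * (rearr a t + rearr b t)) := by
      refine (add_le_add (hsup.trans (mul_le_mul_left
        (ENNReal.ofReal_le_ofReal (h4 β hβ0 hβ (by linarith))) _))
        (hsemi'.trans (mul_le_mul_left
        (ENNReal.ofReal_le_ofReal (h4 (β - α) (by linarith) (by linarith) le_rfl)) _))).trans ?_
      rw [← ENNReal.ofReal_add ra rb, ENNReal.ofReal_mul (by positivity),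
        ENNReal.ofReal_mul (by positivity), ENNReal.ofReal_mul (by positivity)]
      norm_num
      apply le_of_eq
      ring
    rw [ENNReal.ofReal_add (by positivity) rn]
    calc _ ≤ (einf (fun x => φ x - ψ x) + einf ψ) +
          (lipSemiE α (fun x => φ x - ψ x) + lipSemiE α ψ) := by
          conv_lhs => rw [hφe]
          exact add_le_add (einf_add_le _ _) (lipSemiE_add_le _ _ _)
      _ = (einf (fun x => φ x - ψ x) + lipSemiE α (fun x => φ x - ψ x)) +
          (einf ψ + lipSemiE α ψ) := by ring
      _ ≤ _ := add_le_add hs hnψ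
  rw [en, abs_of_nonneg (lipNorm_nonneg _ _)]
  exact ENNReal.toReal_le_of_le_ofReal (by positivity) htot

lemma setLIntegral_comp_two_mul (U : ℝ → ℝ≥0∞) (ε : ℝ) :
    2 * ∫⁻ t in Ioi ε, U (2 * t) = ∫⁻ t in Ioi (2 * ε), U t := by
  have hemb : MeasurableEmbedding fun t : ℝ => 2 * t :=
    (Homeomorph.mulLeft₀ (2 : ℝ) two_ne_zero).measurableEmbedding
  have hpre : (fun t : ℝ => 2 * t) ⁻¹' Ioi (2 * ε) = Ioi ε := by
    ext t; simp
  conv_rhs => rw [← Real.smul_map_volume_mul_left (two_ne_zero : (2 : ℝ) ≠ 0)]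
  rw [Measure.restrict_smul, lintegral_smul_measure, hemb.restrict_map, hemb.lintegral_map, hpre]
  simp

/-- A nonnegative function dominated by `G` plus a contractive dilation of itself is
integrable as soon as `G` is. -/
lemma lintegral_le_of_le_add_dilate {U G : ℝ → ℝ≥0∞} {θ : ℝ} (hθ0 : 0 ≤ θ) (hθ1 : θ < 1)
    (hG : AEMeasurable G (volume.restrict (Ioi 0)))
    (h : ∀ t, 0 < t → U t ≤ G t + ENNReal.ofReal θ * (2 * U (2 * t)))
    (hfin : ∀ ε, 0 < ε → ∫⁻ t in Ioi ε, U t < ⊤) :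
    ENNReal.ofReal (1 - θ) * ∫⁻ t in Ioi 0, U t ≤ ∫⁻ t in Ioi 0, G t := by
  have step : ∀ ε : ℝ, 0 < ε → ENNReal.ofReal (1 - θ) * ∫⁻ t in Ioi ε, U t ≤
      ∫⁻ t in Ioi 0, G t := by
    intro ε hε
    have hsub : Ioi ε ⊆ Ioi (0:ℝ) := Ioi_subset_Ioi hε.le
    have h1 : ∫⁻ t in Ioi ε, U t ≤
        (∫⁻ t in Ioi 0, G t) + ENNReal.ofReal θ * ∫⁻ t in Ioi ε, U t := by
      calc ∫⁻ t in Ioi ε, U t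
          ≤ ∫⁻ t in Ioi ε, (G t + ENNReal.ofReal θ * (2 * U (2 * t))) :=
            setLIntegral_mono' measurableSet_Ioi fun t ht => h t (hε.trans ht)
        _ = (∫⁻ t in Ioi ε, G t) + ENNReal.ofReal θ * (2 * ∫⁻ t in Ioi ε, U (2 * t)) := by
            rw [lintegral_add_left' (hG.mono_measure (Measure.restrict_mono hsub le_rfl)),
              lintegral_const_mul' _ _ ENNReal.ofReal_ne_top,
              lintegral_const_mul' _ _ ENNReal.ofNat_ne_top]
        _ ≤ _ := by
            rw [setLIntegral_comp_two_mul]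
            gcongr
            linarith
    have hsplit : ∫⁻ t in Ioi ε, U t = ENNReal.ofReal (1 - θ) * (∫⁻ t in Ioi ε, U t) +
        ENNReal.ofReal θ * ∫⁻ t in Ioi ε, U t := by
      rw [← add_mul, ← ENNReal.ofReal_add (by linarith) hθ0]
      simp
    exact (ENNReal.add_le_add_iff_right (ENNReal.mul_ne_top ENNReal.ofReal_ne_top
      (hfin ε hε).ne)).1 (hsplit.symm.trans_le h1)
  have hU : Ioi (0:ℝ) = ⋃ n : ℕ, Ioi (1 / ((n : ℝ) + 1)) := by
    ext t
    simp only [mem_Ioi, mem_iUnion]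
    exact ⟨exists_nat_one_div_lt, fun ⟨n, hn⟩ => lt_trans (by positivity) hn⟩
  have hmono : Monotone fun n : ℕ => Ioi (1 / ((n : ℝ) + 1)) := fun m n hmn =>
    Ioi_subset_Ioi (by gcongr)
  conv_lhs => rw [hU]
  rw [setLIntegral_iUnion_of_directed _ hmono.directed_le, ENNReal.mul_iSup]
  exact iSup_le fun n => step _ (by positivity)

/-- The `L^{1/γ,1}` Lorentz integral with values in `[0, ∞]`. -/
def lorentzE {X : Type*} [MeasureSpace X] (γ : ℝ) (g : X → ℝ) : ℝ≥0∞ :=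
  ∫⁻ t in Ioi (0:ℝ), ENNReal.ofReal (t ^ (γ - 1) * rearr g t)

section Lorentz

variable {X : Type*} [MeasureSpace X] {g : X → ℝ}

lemma aemeasurable_rpow_mul_rearr (hg : S0 g) (γ : ℝ) :
    AEMeasurable (fun t => t ^ (γ - 1) * rearr g t) (volume.restrict (Ioi (0:ℝ))) :=
  (by fun_prop : Measurable fun t : ℝ => t ^ (γ - 1)).aemeasurable.mul
    (aemeasurable_restrict_of_antitoneOn measurableSet_Ioi (rearr_antitoneOn hg))

lemma rpow_mul_rearr_nonneg (g : X → ℝ) (γ : ℝ) :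
    0 ≤ᵐ[volume.restrict (Ioi (0:ℝ))] fun t => t ^ (γ - 1) * rearr g t :=
  (ae_restrict_mem measurableSet_Ioi).mono fun t ht =>
    mul_nonneg (Real.rpow_nonneg (le_of_lt ht) _) (rearr_nonneg g t)

lemma lorentz_integrand_eqOn (r : ℝ) (g : X → ℝ) :
    EqOn (fun t => (t ^ (1/r) * rearr g t) ^ (1:ℝ) / t)
      (fun t => t ^ (1/r - 1) * rearr g t) (Ioi (0:ℝ)) := by
  intro t ht
  have ht : 0 < t := ht
  simp only [Real.rpow_one]
  rw [Real.rpow_sub_one ht.ne']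
  ring

lemma memLorentz_one_iff (r : ℝ) :
    MemLorentz r 1 g ↔ S0 g ∧ lorentzE (1/r) g < ⊤ := by
  refine and_congr_right fun hg => ?_
  rw [integrableOn_congr_fun (lorentz_integrand_eqOn r g) measurableSet_Ioi, IntegrableOn,
    Integrable, and_iff_right (aemeasurable_rpow_mul_rearr hg _).aestronglyMeasurable,
    hasFiniteIntegral_iff_ofReal (rpow_mul_rearr_nonneg g _)]
  rfl

lemma lorentzNorm_one_eq (hg : S0 g) (r : ℝ) :
    lorentzNorm r 1 g = (lorentzE (1/r) g).toReal := by
  unfold lorentzNorm lorentzE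
  rw [div_one, Real.rpow_one, setIntegral_congr_fun measurableSet_Ioi (lorentz_integrand_eqOn r g),
    integral_eq_lintegral_of_nonneg_ae (rpow_mul_rearr_nonneg g _)
      (aemeasurable_rpow_mul_rearr hg _).aestronglyMeasurable]

end Lorentz

lemma lorentzE_lipNorm_le {α β : ℝ} (hα : 0 < α) (hαβ : α ≤ β) (hβ : β ≤ 1) {f : ℝ × ℝ → ℝ}
    (hf : Measurable f) {a b n : ℝ → ℝ} (ha : a = fun y => lipNorm β fun x => f (x, y))
    (hb : b = fun x => lipNorm β fun y => f (x, y))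
    (hn : n = fun y => lipNorm α fun x => f (x, y))
    (h1 : ∀ᵐ y, MemLip β fun x => f (x, y)) (h2 : ∀ᵐ x, MemLip β fun y => f (x, y))
    (ha0 : S0 a) (hb0 : S0 b) (haL : lorentzE β a < ⊤) :
    S0 n ∧ ENNReal.ofReal (1 - 2 ^ (-α)) * lorentzE α n ≤
      24 * (lorentzE β a + lorentzE β b) := by
  have hna : ∀ᵐ y, |n y| ≤ 3 * |a y| := by
    filter_upwards [h1] with y hy
    rw [hn, ha, abs_of_nonneg (lipNorm_nonneg _ _), abs_of_nonneg (lipNorm_nonneg _ _)]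
    exact lipNorm_le_three_mul hα.le hαβ hy
  have hn0 : S0 n := S0_of_ae_le ha0 (hn ▸ measurable_lipNorm_section hα hf) three_pos hna
  have hn3 : ∀ t, 0 < t → rearr n t ≤ 3 * rearr a t := fun t ht =>
    rearr_le_mul_of_ae_le ha0 three_pos hna ht
  refine ⟨hn0, ?_⟩
  have hGint : 24 * (lorentzE β a + lorentzE β b) = ∫⁻ t in Ioi (0:ℝ),
      24 * (ENNReal.ofReal (t ^ (β - 1) * rearr a t) +
        ENNReal.ofReal (t ^ (β - 1) * rearr b t)) := by
    rw [lintegral_const_mul' _ _ (by norm_num),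
      lintegral_add_left' (aemeasurable_rpow_mul_rearr ha0 β).ennreal_ofReal]
    rfl
  rw [hGint]
  refine lintegral_le_of_le_add_dilate (by positivity)
    (Real.rpow_lt_one_of_one_lt_of_neg one_lt_two (by linarith))
    (((aemeasurable_rpow_mul_rearr ha0 β).ennreal_ofReal.add
      (aemeasurable_rpow_mul_rearr hb0 β).ennreal_ofReal).const_mul 24) ?_ ?_
  · intro t ht
    have ra := rearr_nonneg a t
    have rb := rearr_nonneg b t
    have rn := rearr_nonneg n (2 * t)
    have key : t ^ (α - 1) * rearr n t ≤ 24 * (t ^ (β - 1) * rearr a t + t ^ (β - 1) * rearr b t) +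
        2 ^ (-α) * (2 * ((2 * t) ^ (α - 1) * rearr n (2 * t))) := by
      have e2 : 2 ^ (-α) * (2 * ((2 * t) ^ (α - 1) * rearr n (2 * t))) =
          t ^ (α - 1) * rearr n (2 * t) := by
        have : (2:ℝ) ^ (-α) * 2 * 2 ^ (α - 1) = 1 := by
          rw [← Real.rpow_add_one two_ne_zero, ← Real.rpow_add two_pos]
          simp
        rw [Real.mul_rpow two_pos.le ht.le]
        linear_combination (t ^ (α - 1) * rearr n (2 * t)) * this
      rw [e2]
      rcases le_total t 1 with h | h
      · have hs := mul_le_mul_of_nonneg_left (rearr_lipNorm_step hα hαβ hβ hf ha hb hn h1 h2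
          ha0 hb0 hn0 ht h) (Real.rpow_nonneg ht.le (α - 1))
        refine hs.trans (le_of_eq ?_)
        have e : t ^ (β - 1) = t ^ (α - 1) * t ^ (β - α) := by
          rw [← Real.rpow_add ht]; congr 1; ring
        rw [e]; ring
      · have hw : t ^ (α - 1) ≤ t ^ (β - 1) :=
          Real.rpow_le_rpow_of_exponent_le h (by linarith)
        calc t ^ (α - 1) * rearr n t ≤ t ^ (β - 1) * (3 * rearr a t) :=
              mul_le_mul hw (hn3 t ht) (rearr_nonneg _ _) (by positivity)
          _ ≤ _ := by
            have p1 : 0 ≤ t ^ (β - 1) * rearr a t := by positivity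
            have p2 : 0 ≤ t ^ (β - 1) * rearr b t := by positivity
            have p3 : 0 ≤ t ^ (α - 1) * rearr n (2 * t) := by positivity
            linarith
    refine (ENNReal.ofReal_le_ofReal key).trans (le_of_eq ?_)
    rw [ENNReal.ofReal_add (by positivity) (by positivity), ENNReal.ofReal_mul (by norm_num),
      ENNReal.ofReal_add (by positivity) (by positivity),
      ENNReal.ofReal_mul (p := 2 ^ (-α)) (by positivity),
      ENNReal.ofReal_mul (p := 2) (by positivity)]
    norm_num
  · intro ε hε
    calc ∫⁻ t in Ioi ε, ENNReal.ofReal (t ^ (α - 1) * rearr n t)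
        ≤ ∫⁻ t in Ioi ε, ENNReal.ofReal (ε ^ (α - β) * 3) *
            ENNReal.ofReal (t ^ (β - 1) * rearr a t) := by
          refine setLIntegral_mono' measurableSet_Ioi fun t ht => ?_
          have ht : ε < t := ht
          have ht0 : 0 < t := hε.trans ht
          rw [← ENNReal.ofReal_mul (by positivity)]
          refine ENNReal.ofReal_le_ofReal ?_
          have e : t ^ (α - 1) = t ^ (α - β) * t ^ (β - 1) := by
            rw [← Real.rpow_add ht0]; congr 1; ring
          rw [e]
          calc _ ≤ ε ^ (α - β) * t ^ (β - 1) * (3 * rearr a t) := by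
                refine mul_le_mul (mul_le_mul_of_nonneg_right
                  (Real.rpow_le_rpow_of_nonpos hε ht.le (by linarith)) (by positivity))
                  (hn3 t ht0) (rearr_nonneg _ _) (by positivity)
            _ = _ := by ring
      _ = ENNReal.ofReal (ε ^ (α - β) * 3) *
            ∫⁻ t in Ioi ε, ENNReal.ofReal (t ^ (β - 1) * rearr a t) :=
          lintegral_const_mul' _ _ ENNReal.ofReal_ne_top
      _ < ⊤ := ENNReal.mul_lt_top ENNReal.ofReal_lt_top
          ((lintegral_mono_set (Ioi_subset_Ioi hε.le)).trans_lt haL)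

lemma MemUp.swap {p : ℝ} {f : ℝ × ℝ → ℝ} (h : MemUp p f) : MemUp p (f ∘ Prod.swap) :=
  ⟨h.1.comp measurable_swap, h.2.2.1, h.2.1, h.2.2.2.2, h.2.2.2.1⟩

/-- The embedding for the sections in the first variable. -/
lemma MemUp.section_embedding {p q : ℝ} (hp : 1 ≤ p) (hpq : p < q) {f : ℝ × ℝ → ℝ}
    (hf : MemUp p f) :
    (∀ᵐ y : ℝ, MemLip (1/q) fun x => f (x, y)) ∧
    MemLorentz q 1 (fun y => lipNorm (1/q) fun x => f (x, y)) ∧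
    lorentzNorm q 1 (fun y => lipNorm (1/q) fun x => f (x, y)) ≤
      24 / (1 - 2 ^ (-(1/q))) * (lorentzNorm p 1 (fun y => lipNorm (1/p) fun x => f (x, y)) +
        lorentzNorm p 1 (fun x => lipNorm (1/p) fun y => f (x, y))) := by
  have hp0 : 0 < p := by linarith
  have hq0 : 0 < q := by linarith
  have hα : 0 < 1 / q := by positivity
  have hαβ : 1 / q ≤ 1 / p := one_div_le_one_div_of_le hp0 hpq.le
  have hβ : 1 / p ≤ 1 := by rw [div_le_one hp0]; exact hp
  obtain ⟨hfm, h1, h2, h3, h4⟩ := hf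
  rw [memLorentz_one_iff] at h3 h4
  obtain ⟨hn0, hle⟩ := lorentzE_lipNorm_le hα hαβ hβ hfm rfl rfl rfl h1 h2 h3.1 h4.1 h3.2
  have hθ : 0 < 1 - (2:ℝ) ^ (-(1/q)) :=
    sub_pos.2 (Real.rpow_lt_one_of_one_lt_of_neg one_lt_two (by linarith))
  have hrhs : 24 * (lorentzE (1/p) (fun y => lipNorm (1/p) fun x => f (x, y)) +
      lorentzE (1/p) (fun x => lipNorm (1/p) fun y => f (x, y))) ≠ ⊤ :=
    ENNReal.mul_ne_top (by norm_num) (ENNReal.add_ne_top.2 ⟨h3.2.ne, h4.2.ne⟩)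
  refine ⟨h1.mono fun y hy => hy.mono hα.le hαβ, (memLorentz_one_iff q).2 ⟨hn0, ?_⟩, ?_⟩
  · rw [lt_top_iff_ne_top]
    intro htop
    rw [htop, ENNReal.mul_top (by simpa using hθ)] at hle
    exact hrhs (top_le_iff.1 hle)
  · rw [lorentzNorm_one_eq hn0, lorentzNorm_one_eq h3.1, lorentzNorm_one_eq h4.1,
      div_mul_eq_mul_div, le_div_iff₀' hθ]
    have := ENNReal.toReal_mono hrhs hle
    rwa [ENNReal.toReal_mul, ENNReal.toReal_mul, ENNReal.toReal_add h3.2.ne h4.2.ne,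
      ENNReal.toReal_ofReal hθ.le] at this

/-- For `1 ≤ p < q < ∞` we have `U_p(ℝ²) ⊆ U_q(ℝ²)`, and
`‖N¹_q f‖_{q,1} + ‖N²_q f‖_{q,1} ≤ c (‖N¹_p f‖_{p,1} + ‖N²_p f‖_{p,1})`
with `c = c(p,q)`. -/
theorem stmt15 (p q : ℝ) (hp : 1 ≤ p) (hpq : p < q) :
    ∃ c : ℝ, 0 < c ∧ ∀ f : ℝ × ℝ → ℝ, MemUp p f →
      MemUp q f ∧
      lorentzNorm q 1 (fun y => lipNorm (1/q) (fun x => f (x, y))) +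
          lorentzNorm q 1 (fun x => lipNorm (1/q) (fun y => f (x, y))) ≤
        c * (lorentzNorm p 1 (fun y => lipNorm (1/p) (fun x => f (x, y))) +
             lorentzNorm p 1 (fun x => lipNorm (1/p) (fun y => f (x, y)))) := by
  have hθ : 0 < 1 - (2:ℝ) ^ (-(1/q)) :=
    sub_pos.2 (Real.rpow_lt_one_of_one_lt_of_neg one_lt_two
      (neg_neg_of_pos (one_div_pos.2 (by linarith))))
  refine ⟨2 * (24 / (1 - 2 ^ (-(1/q)))), by positivity, fun f hf => ?_⟩
  obtain ⟨h1, h2, h3⟩ := hf.section_embedding hp hpq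
  obtain ⟨k1, k2, k3⟩ := hf.swap.section_embedding hp hpq
  refine ⟨⟨hf.1, h1, k1, h2, k2⟩, ?_⟩
  simp only [Function.comp_apply, Prod.swap_prod_mk] at k3
  linarith

end
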